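/- Let (u,m) be a classical solution of the nonlocal MFG system with m > 0 on Q, and let K_f : 𝕋^d × [0,T] × 𝕋^d → ℝ and K_g : 𝕋^d × 𝕋^d → ℝ be continuous kernels such that for every t ∈ [0,T] and every continuous w : 𝕋^d → ℝ with ∫_{𝕋^d} w = 0 one has ∬ K_f(x,t,y)w(x)w(y)dxdy ≥ 0 and ∬ K_g(x,y)w(x)w(y)dxdy ≥ 0. Then any classical solution (v,ρ) of the linearized system (i) -∂_t v - Δv + H_p(x,Du)·Dv = ∫_{𝕋^d} K_f(x,t,y)ρ(y,t)dy in Q, (ii) ∂_t ρ - Δρ - div(ρ·H_p(x,Du)) = div(m·H_{pp}(x,Du)Dv) in Q, with ρ(x,0)=0 and v(x,T)=∫_{𝕋^d} K_g(x,y)ρ(y,T)dy, is the trivial solution (v,ρ)=(0,0). -/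

import Mathlib

open Set MeasureTheory
open scoped RealInnerProductSpace

noncomputable section

/-- Euclidean space ℝ^d, used as the universal cover of the flat torus 𝕋^d. -/
abbrev Ed (d : ℕ) : Type := EuclideanSpace ℝ (Fin d)

variable {d : ℕ}

/-- The `i`-th unit coordinate vector of ℝ^d. -/
def ebasis (d : ℕ) (i : Fin d) : Ed d := EuclideanSpace.single i 1

/-- Second spatial partial derivative `∂²f/∂xᵢ∂xⱼ`. -/
def partial2 (f : Ed d → ℝ) (i j : Fin d) (x : Ed d) : ℝ :=
  fderiv ℝ (fun y => fderiv ℝ f y (ebasis d j)) x (ebasis d i)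

/-- Laplacian in the space variable. -/
def lap (f : Ed d → ℝ) (x : Ed d) : ℝ := ∑ i, partial2 f i i x

/-- Divergence of a vector field in the space variable. -/
def diverg (F : Ed d → Ed d) (x : Ed d) : ℝ :=
  ∑ i, ⟪fderiv ℝ F x (ebasis d i), ebasis d i⟫

/-- Spatial gradient. -/
def sgrad (f : Ed d → ℝ) (x : Ed d) : Ed d := gradient f x

/-- ℤ^d-periodicity: a function on ℝ^d descending to the flat torus 𝕋^d. -/
def ZPeriodic (f : Ed d → ℝ) : Prop :=
  ∀ (x : Ed d) (i : Fin d), f (x + ebasis d i) = f x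

/-- Time derivative within the time interval `[0,T]`. -/
def tderiv (T : ℝ) (w : ℝ → Ed d → ℝ) (t : ℝ) (x : Ed d) : ℝ :=
  derivWithin (fun s => w s x) (Icc 0 T) t

/-- `w` is bounded and parabolically `a`-Hölder on `Q = 𝕋^d × [0,T]`. -/
def HolderBddQ (T a : ℝ) (w : ℝ → Ed d → ℝ) : Prop :=
  ∃ C : ℝ, (∀ t ∈ Icc (0:ℝ) T, ∀ x : Ed d, |w t x| ≤ C) ∧
    ∀ t ∈ Icc (0:ℝ) T, ∀ s ∈ Icc (0:ℝ) T, ∀ x y : Ed d,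
      |w t x - w s y| ≤ C * (‖x - y‖ ^ 2 + |t - s|) ^ (a / 2)

/-- Membership in the parabolic Hölder space `C^{2+a,1+a/2}(Q)` (including
ℤ^d-periodicity in the space variable): `w` is C² in space, differentiable in
time, and `w`, `Dw`, `D²w`, `∂ₜw` are bounded and parabolically Hölder. -/
def InC2alpha (T a : ℝ) (w : ℝ → Ed d → ℝ) : Prop :=
  (∀ t ∈ Icc (0:ℝ) T, ZPeriodic (w t)) ∧
  (∀ t ∈ Icc (0:ℝ) T, ContDiff ℝ 2 (w t)) ∧
  (∀ x : Ed d, DifferentiableOn ℝ (fun s => w s x) (Icc 0 T)) ∧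
  HolderBddQ T a w ∧
  (∀ i : Fin d, HolderBddQ T a fun t x => ⟪sgrad (w t) x, ebasis d i⟫) ∧
  (∀ i j : Fin d, HolderBddQ T a fun t x => partial2 (w t) i j x) ∧
  HolderBddQ T a fun t x => tderiv T w t x

/-- Membership in `C^{2+a}(𝕋^d)` for time-independent functions. -/
def InC2alphaSpace (a : ℝ) (g : Ed d → ℝ) : Prop :=
  ZPeriodic g ∧ ContDiff ℝ 2 g ∧
  ∃ C : ℝ, ∀ (i j : Fin d) (x y : Ed d),
    |partial2 g i j x - partial2 g i j y| ≤ C * ‖x - y‖ ^ a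

/-- The fundamental domain `[0,1)^d` of the torus, used for integration. -/
def cube (d : ℕ) : Set (Ed d) := {x : Ed d | ∀ i, x i ∈ Ico (0:ℝ) 1}


/-- `H_p`: gradient of the separable Hamiltonian `H = H(x,p)` in `p`. -/
def HamP2 (H : Ed d → Ed d → ℝ) (x p : Ed d) : Ed d := gradient (H x) p

/-- `H_pp`: Hessian of `H = H(x,p)` in `p`, as a continuous linear map. -/
def HamPP2 (H : Ed d → Ed d → ℝ) (x p : Ed d) : Ed d →L[ℝ] Ed d :=
  fderiv ℝ (fun q => HamP2 H x q) p

/-- Assumptions on the separable Hamiltonian `H = H(x,p)`: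
`H ∈ C⁴(𝕋^d × ℝ^d)` (periodic in `x`), `|H_px| ≤ C̄(|p|+1)`, `|H_pp| ≤ C̄`,
`|H_ppp| ≤ C̄`, and `H_pp(x,p)` positive definite for all `(x,p)`. -/
def HAssumpNonlocal (H : Ed d → Ed d → ℝ) : Prop :=
  ContDiff ℝ 4 (fun q : Ed d × Ed d => H q.1 q.2) ∧
  (∀ (p : Ed d), ZPeriodic fun x => H x p) ∧
  (∃ Cb : ℝ, 0 < Cb ∧ ∀ x p : Ed d,
    ‖fderiv ℝ (fun y => HamP2 H y p) x‖ ≤ Cb * (‖p‖ + 1) ∧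
    ‖HamPP2 H x p‖ ≤ Cb ∧
    ‖iteratedFDeriv ℝ 3 (fun q => H x q) p‖ ≤ Cb) ∧
  (∀ x p q : Ed d, q ≠ 0 → 0 < ⟪HamPP2 H x p q, q⟫)

/-- The MFG system with separable Hamiltonian and nonlocal couplings
`f, g : densities → functions`:
(i)  `-∂ₜu - Δu + H(x,Du) = f[m(t)](x)`;
(ii) `∂ₜm - Δm - div(m·H_p(x,Du)) = 0`;
with `m(·,0) = m₀` and `u(·,T) = g[m(T)]`. -/
def SolvesMFGNonlocal (T : ℝ) (H : Ed d → Ed d → ℝ)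
    (f g : (Ed d → ℝ) → Ed d → ℝ) (m0 : Ed d → ℝ)
    (u m : ℝ → Ed d → ℝ) : Prop :=
  (∀ t ∈ Icc (0:ℝ) T, ∀ x : Ed d,
    -tderiv T u t x - lap (u t) x + H x (sgrad (u t) x) = f (m t) x) ∧
  (∀ t ∈ Icc (0:ℝ) T, ∀ x : Ed d,
    tderiv T m t x - lap (m t) x -
      diverg (fun y => m t y • HamP2 H y (sgrad (u t) y)) x = 0) ∧
  (∀ x : Ed d, m 0 x = m0 x) ∧ (∀ x : Ed d, u T x = g (m T) x)

/-- Continuity, periodicity and positivity of the coupling kernels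
`K_f(x,t,y)` and `K_g(x,y)` (playing the role of the flat derivatives
`δf/δm[m(t)](x)(y)` and `δg/δm[m(T)](x)(y)`): for every `t ∈ [0,T]` and every
continuous periodic `w` with `∫_{𝕋^d} w = 0`,
`∬ K_f(x,t,y)w(x)w(y) dxdy ≥ 0` and `∬ K_g(x,y)w(x)w(y) dxdy ≥ 0`. -/
def KernelAssump (T : ℝ) (Kf : Ed d → ℝ → Ed d → ℝ)
    (Kg : Ed d → Ed d → ℝ) : Prop :=
  Continuous (fun q : Ed d × ℝ × Ed d => Kf q.1 q.2.1 q.2.2) ∧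
  Continuous (fun q : Ed d × Ed d => Kg q.1 q.2) ∧
  (∀ (t : ℝ) (y : Ed d), ZPeriodic fun x => Kf x t y) ∧
  (∀ (x : Ed d) (t : ℝ), ZPeriodic fun y => Kf x t y) ∧
  (∀ y : Ed d, ZPeriodic fun x => Kg x y) ∧
  (∀ x : Ed d, ZPeriodic fun y => Kg x y) ∧
  (∀ t ∈ Icc (0:ℝ) T, ∀ w : Ed d → ℝ, Continuous w → ZPeriodic w →
    (∫ y in cube d, w y) = 0 →
    0 ≤ ∫ x in cube d, ∫ y in cube d, Kf x t y * w x * w y) ∧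
  (∀ w : Ed d → ℝ, Continuous w → ZPeriodic w →
    (∫ y in cube d, w y) = 0 →
    0 ≤ ∫ x in cube d, ∫ y in cube d, Kg x y * w x * w y)

def VPer {β : Type*} (F : Ed d → β) : Prop :=
  ∀ (x : Ed d) (i : Fin d), F (x + ebasis d i) = F x

def bas (d : ℕ) : Module.Basis (Fin d) ℝ (Ed d) := (EuclideanSpace.basisFun (Fin d) ℝ).toBasis

lemma bas_apply (i : Fin d) : bas d i = ebasis d i := by
  simp [bas, ebasis]

lemma cube_eq : cube d = ZSpan.fundamentalDomain (bas d) := by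
  ext x
  simp [cube, ZSpan.mem_fundamentalDomain, bas]

lemma VPer.lattice {β : Type*} {F : Ed d → β} (h : VPer F) (c : Ed d)
    (hc : c ∈ Submodule.span ℤ (Set.range (bas d))) : Function.Periodic F c := by
  induction hc using Submodule.span_induction with
  | mem x hx =>
    obtain ⟨i, rfl⟩ := hx
    intro x
    rw [bas_apply]
    exact h x i
  | zero => intro x; simp
  | add x y _ _ hx hy => exact hx.add_period hy
  | smul n x _ hx => exact hx.zsmul n

lemma cube_meas : MeasurableSet (cube d) := by
  rw [cube_eq]; exact ZSpan.fundamentalDomain_measurableSet _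

lemma cube_bdd : ∃ R : ℝ, cube d ⊆ Metric.closedBall 0 R := by
  rw [cube_eq]
  exact (ZSpan.fundamentalDomain_isBounded (bas d)).subset_closedBall 0

lemma cube_fin : volume (cube d) < ⊤ := by
  rw [cube_eq]
  exact (ZSpan.fundamentalDomain_isBounded (bas d)).measure_lt_top

instance : IsFiniteMeasure (volume.restrict (cube d)) :=
  ⟨by simpa using cube_fin⟩

lemma cube_int {f : Ed d → ℝ} (hf : Continuous f) : IntegrableOn f (cube d) := by
  obtain ⟨R, hR⟩ := cube_bdd (d := d)
  exact (hf.continuousOn.integrableOn_compact (isCompact_closedBall 0 R)).mono_set hR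

lemma cube_fd : IsAddFundamentalDomain (Submodule.span ℤ (Set.range (bas d))) (cube d)
    (volume : Measure (Ed d)) := by
  rw [cube_eq]; exact ZSpan.isAddFundamentalDomain _ _

instance : VAddCommClass (Ed d) (Submodule.span ℤ (Set.range (bas d))) (Ed d) :=
  ⟨fun a b c => by
    change a + ((b : Ed d) + c) = (b : Ed d) + (a + c)
    abel⟩

instance : VAddInvariantMeasure (Submodule.span ℤ (Set.range (bas d))) (Ed d) volume :=
  inferInstanceAs <| VAddInvariantMeasure (Submodule.span ℤ (Set.range (bas d))).toAddSubgroup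
    (Ed d) volume

instance : MeasurableConstVAdd (Submodule.span ℤ (Set.range (bas d))) (Ed d) :=
  inferInstanceAs <| MeasurableConstVAdd (Submodule.span ℤ (Set.range (bas d))).toAddSubgroup
    (Ed d)

open scoped Pointwise in
lemma int_shift {f : Ed d → ℝ} (h : VPer f) (c : Ed d) :
    ∫ x in cube d, f (c + x) = ∫ x in cube d, f x := by
  have h1 := (measurePreserving_add_left (volume : Measure (Ed d)) c).setIntegral_image_emb
    (measurableEmbedding_addLeft c) f (cube d)
  rw [← h1]
  have h2 : IsAddFundamentalDomain (Submodule.span ℤ (Set.range (bas d))) (c +ᵥ cube d)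
    (volume : Measure (Ed d)) := cube_fd.vadd_of_comm c
  exact h2.setIntegral_eq cube_fd (fun g x => by
    change f ((g : Ed d) + x) = f x
    rw [add_comm]
    exact h.lattice g g.2 x)

lemma zero_of_int {f : Ed d → ℝ} (hc : Continuous f) (h : VPer f) (h0 : ∀ x, 0 ≤ f x)
    (hi : ∫ x in cube d, f x = 0) (x : Ed d) : f x = 0 := by
  have h1 := (setIntegral_eq_zero_iff_of_nonneg_ae (Filter.Eventually.of_forall h0)
    (cube_int hc)).1 hi
  have h2 : volume {x | f x ≠ 0} = 0 := by
    refine cube_fd.measure_zero_of_invariant _ ?_ ?_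
    · intro g
      ext y
      rw [Set.mem_vadd_set_iff_neg_vadd_mem]
      change f (((-g : Submodule.span ℤ (Set.range (bas d))) : Ed d) + y) ≠ 0 ↔ f y ≠ 0
      rw [add_comm, h.lattice _ (-g).2 y]
    · rw [Filter.EventuallyEq, ae_restrict_iff' cube_meas, ae_iff] at h1
      convert h1 using 2
      ext y
      simp [and_comm]
  have h3 : f =ᵐ[volume] fun _ => (0:ℝ) := h2
  exact congrFun ((hc.ae_eq_iff_eq volume continuous_const).1 h3) x

lemma VPer.fderiv {E : Type*} [NormedAddCommGroup E] [NormedSpace ℝ E] {F : Ed d → E}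
    (h : VPer F) : VPer (fderiv ℝ F) := by
  intro x i
  rw [← fderiv_comp_add_right]
  congr 1
  funext y
  exact h y i

lemma int_deriv_zero {f : Ed d → ℝ} (hf : ContDiff ℝ 1 f) (h : VPer f) (e : Ed d) :
    ∫ x in cube d, fderiv ℝ f x e = 0 := by
  obtain ⟨R, hR⟩ := cube_bdd (d := d)
  have hcont : Continuous fun x => fderiv ℝ f x e :=
    (hf.continuous_fderiv (by norm_num)).clm_apply continuous_const
  obtain ⟨C, hC⟩ := (isCompact_closedBall (0 : Ed d) (R + ‖e‖)).exists_bound_of_continuousOn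
    hcont.continuousOn
  have hd : ∀ (s : ℝ) (x : Ed d),
      HasDerivAt (fun s : ℝ => f (s • e + x)) (fderiv ℝ f (s • e + x) e) s := by
    intro s x
    have h1 : HasDerivAt (fun s : ℝ => s • e + x) e s := by
      simpa using ((hasDerivAt_id s).smul_const e).add_const x
    exact ((hf.differentiable (by norm_num)) (s • e + x)).hasFDerivAt.comp_hasDerivAt s h1
  have key := hasDerivAt_integral_of_dominated_loc_of_deriv_le
    (μ := volume.restrict (cube d)) (F := fun (s : ℝ) x => f (s • e + x))
    (F' := fun (s : ℝ) x => fderiv ℝ f (s • e + x) e) (x₀ := 0) (bound := fun _ => C)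
    (s := Metric.ball 0 1) (Metric.ball_mem_nhds _ one_pos)
    (Filter.Eventually.of_forall fun s => by
      have := hf.continuous
      exact (Continuous.aestronglyMeasurable (by fun_prop)))
    (by
      have := hf.continuous
      exact cube_int (by fun_prop))
    (Continuous.aestronglyMeasurable (hcont.comp (by fun_prop)))
    (by
      refine (ae_restrict_iff' cube_meas).2 (Filter.Eventually.of_forall fun x hx s hs => ?_)
      apply hC
      have h1 := hR hx
      simp only [mem_closedBall_zero_iff, mem_ball_zero_iff, Real.norm_eq_abs] at *
      calc ‖s • e + x‖ ≤ ‖s • e‖ + ‖x‖ := norm_add_le _ _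
        _ = |s| * ‖e‖ + ‖x‖ := by rw [norm_smul, Real.norm_eq_abs]
        _ ≤ 1 * ‖e‖ + R := by gcongr
        _ = R + ‖e‖ := by ring)
    (integrable_const _)
    (Filter.Eventually.of_forall fun x s _ => hd s x)
  have h2 := key.2
  have h3 : (fun s : ℝ => ∫ x in cube d, f (s • e + x)) = fun _ => ∫ x in cube d, f x := by
    funext s
    exact int_shift h _
  rw [h3] at h2
  have := h2.unique (hasDerivAt_const _ _)
  simpa using this

lemma inner_grad (f : Ed d → ℝ) (x e : Ed d) : ⟪sgrad f x, e⟫ = fderiv ℝ f x e := by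
  simp [sgrad, gradient]

lemma inner_coord_sum (a b : Ed d) : ∑ i, ⟪a, ebasis d i⟫ * ⟪b, ebasis d i⟫ = ⟪a, b⟫ := by
  simp [ebasis, PiLp.inner_apply, mul_comm]

lemma sum_ebasis (b : Ed d) : ∑ i, ⟪b, ebasis d i⟫ • ebasis d i = b := by
  ext j
  simp [ebasis, EuclideanSpace.inner_single_right, Pi.single_apply]

lemma fderiv_inner_e {F : Ed d → Ed d} (hF : ContDiff ℝ 1 F) (x e e' : Ed d) :
    fderiv ℝ (fun y => ⟪F y, e⟫) x e' = ⟪fderiv ℝ F x e', e⟫ := by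
  rw [fderiv_inner_apply ℝ (hF.differentiable (by norm_num) x) (differentiableAt_const e)]
  simp

lemma diverg_cont {F : Ed d → Ed d} (hF : ContDiff ℝ 1 F) : Continuous (diverg F) := by
  have := hF.continuous_fderiv (by norm_num)
  unfold diverg
  fun_prop

lemma int_diverg {F : Ed d → Ed d} (hF : ContDiff ℝ 1 F) (h : VPer F) :
    ∫ x in cube d, diverg F x = 0 := by
  have hc := hF.continuous_fderiv (by norm_num)
  unfold diverg
  rw [integral_finsetSum]
  · refine Finset.sum_eq_zero fun i _ => ?_
    have h1 : ContDiff ℝ 1 fun y => ⟪F y, ebasis d i⟫ := hF.inner ℝ contDiff_const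
    rw [← int_deriv_zero h1 (fun x j => by simp only [h x j]) (ebasis d i)]
    simp only [fderiv_inner_e hF]
  · intro i _
    exact cube_int (by fun_prop)

lemma diverg_smul {φ : Ed d → ℝ} {F : Ed d → Ed d} (hφ : ContDiff ℝ 1 φ) (hF : ContDiff ℝ 1 F)
    (x : Ed d) : diverg (fun y => φ y • F y) x = φ x * diverg F x + ⟪F x, sgrad φ x⟫ := by
  unfold diverg
  have h1 : fderiv ℝ (fun y => φ y • F y) x = _ :=
    fderiv_fun_smul (hφ.differentiable (by norm_num) x) (hF.differentiable (by norm_num) x)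
  rw [h1, ← inner_coord_sum, Finset.mul_sum, ← Finset.sum_add_distrib]
  refine Finset.sum_congr rfl fun i _ => ?_
  rw [inner_grad]
  simp [inner_add_left, inner_smul_left]
  ring

lemma ibp {φ : Ed d → ℝ} {F : Ed d → Ed d} (hφ : ContDiff ℝ 1 φ) (hF : ContDiff ℝ 1 F)
    (pφ : VPer φ) (pF : VPer F) :
    ∫ x in cube d, φ x * diverg F x = - ∫ x in cube d, ⟪F x, sgrad φ x⟫ := by
  have h := int_diverg (hφ.smul hF) (fun x i => by simp only [Pi.smul_apply', pφ x i, pF x i])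
  have e : ∀ x, diverg (φ • F) x = φ x * diverg F x + ⟪F x, sgrad φ x⟫ :=
    fun x => diverg_smul hφ hF x
  simp only [e] at h
  have c1 : Continuous fun x => ⟪F x, sgrad φ x⟫ := by
    have := hF.continuous
    have h3 : Continuous (sgrad φ) := by
      unfold sgrad gradient
      have := hφ.continuous_fderiv (by norm_num)
      fun_prop
    fun_prop
  have c0 : Continuous fun x => φ x * diverg F x := hφ.continuous.mul (diverg_cont hF)
  rw [integral_add (cube_int c0) (cube_int c1)] at h
  linarith

lemma sgrad_contDiff {f : Ed d → ℝ} (hf : ContDiff ℝ 2 f) : ContDiff ℝ 1 (sgrad f) := by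
  have h1 : ContDiff ℝ 1 (fderiv ℝ f) := hf.fderiv_right (by norm_num)
  unfold sgrad gradient
  exact (InnerProductSpace.toDual ℝ (Ed d)).symm.contDiff.comp h1

lemma sgrad_per {f : Ed d → ℝ} (hf : VPer f) : VPer (sgrad f) := by
  intro x i
  simp only [sgrad, gradient]
  rw [hf.fderiv x i]

lemma lap_eq {f : Ed d → ℝ} (hf : ContDiff ℝ 2 f) (x : Ed d) : lap f x = diverg (sgrad f) x := by
  unfold lap diverg partial2
  refine Finset.sum_congr rfl fun i _ => ?_
  rw [← fderiv_inner_e (sgrad_contDiff hf)]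
  simp only [inner_grad]

lemma HamP2_contDiff {H : Ed d → Ed d → ℝ}
    (hH : ContDiff ℝ 4 (fun q : Ed d × Ed d => H q.1 q.2)) :
    ContDiff ℝ 3 (fun q : Ed d × Ed d => HamP2 H q.1 q.2) := by
  have h1 : ContDiff ℝ 3 (fun q : Ed d × Ed d => fderiv ℝ (H q.1) q.2) := by
    refine ContDiff.fderiv (f := fun (q : Ed d × Ed d) p => H q.1 p) (m := 4) ?_ contDiff_snd
      (by norm_num)
    exact hH.comp ((contDiff_fst.comp contDiff_fst).prodMk contDiff_snd)
  unfold HamP2 gradient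
  exact (InnerProductSpace.toDual ℝ (Ed d)).symm.contDiff.comp h1

lemma HamPP2_contDiff {H : Ed d → Ed d → ℝ}
    (hH : ContDiff ℝ 4 (fun q : Ed d × Ed d => H q.1 q.2)) :
    ContDiff ℝ 2 (fun q : Ed d × Ed d => HamPP2 H q.1 q.2) := by
  unfold HamPP2
  refine ContDiff.fderiv (f := fun (q : Ed d × Ed d) p => HamP2 H q.1 p) (m := 3) ?_ contDiff_snd
      (by norm_num)
  exact (HamP2_contDiff hH).comp ((contDiff_fst.comp contDiff_fst).prodMk contDiff_snd)

/-- Regularity in time sufficient for differentiating space integrals. -/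
structure TReg (T : ℝ) (w w' : ℝ → Ed d → ℝ) : Prop where
  cont : ∀ t ∈ Icc (0:ℝ) T, Continuous (w t)
  bdd : ∃ C : ℝ, ∀ t ∈ Icc (0:ℝ) T, ∀ x, |w t x| ≤ C
  contT : ∀ x, ContinuousOn (fun s => w s x) (Icc 0 T)
  cont' : ∀ t ∈ Ioo (0:ℝ) T, Continuous (w' t)
  bdd' : ∃ C : ℝ, ∀ t ∈ Ioo (0:ℝ) T, ∀ x, |w' t x| ≤ C
  deriv : ∀ t ∈ Ioo (0:ℝ) T, ∀ x, HasDerivAt (fun s => w s x) (w' t x) t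

lemma TReg.mul {T : ℝ} {w w' z z' : ℝ → Ed d → ℝ} (h : TReg T w w') (k : TReg T z z') :
    TReg T (fun t x => w t x * z t x) (fun t x => w' t x * z t x + w t x * z' t x) where
  cont t ht := (h.cont t ht).mul (k.cont t ht)
  bdd := by
    obtain ⟨C, hC⟩ := h.bdd
    obtain ⟨D, hD⟩ := k.bdd
    refine ⟨C * D, fun t ht x => ?_⟩
    rw [abs_mul]
    have := (abs_nonneg _).trans (hC t ht x)
    exact mul_le_mul (hC t ht x) (hD t ht x) (abs_nonneg _) this
  contT x := (h.contT x).mul (k.contT x)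
  cont' t ht := ((h.cont' t ht).mul (k.cont t (Ioo_subset_Icc_self ht))).add
    ((h.cont t (Ioo_subset_Icc_self ht)).mul (k.cont' t ht))
  bdd' := by
    obtain ⟨C, hC⟩ := h.bdd
    obtain ⟨D, hD⟩ := k.bdd
    obtain ⟨C', hC'⟩ := h.bdd'
    obtain ⟨D', hD'⟩ := k.bdd'
    refine ⟨C' * D + C * D', fun t ht x => ?_⟩
    have ht' := Ioo_subset_Icc_self ht
    refine (abs_add_le _ _).trans ?_
    rw [abs_mul, abs_mul]
    have h1 := (abs_nonneg _).trans (hC t ht' x)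
    have h2 := (abs_nonneg _).trans (hC' t ht x)
    exact add_le_add (mul_le_mul (hC' t ht x) (hD t ht' x) (abs_nonneg _) h2)
      (mul_le_mul (hC t ht' x) (hD' t ht x) (abs_nonneg _) h1)
  deriv t ht x := (h.deriv t ht x).mul (k.deriv t ht x)

lemma TReg.intCont {T : ℝ} {w w' : ℝ → Ed d → ℝ} (h : TReg T w w') :
    ContinuousOn (fun t => ∫ x in cube d, w t x) (Icc 0 T) := by
  obtain ⟨C, hC⟩ := h.bdd
  intro t ht
  refine continuousWithinAt_of_dominated (bound := fun _ => C) ?_ ?_ (integrable_const _) ?_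
  · filter_upwards [self_mem_nhdsWithin] with s hs
    exact (h.cont s hs).aestronglyMeasurable
  · filter_upwards [self_mem_nhdsWithin] with s hs
    exact Filter.Eventually.of_forall fun x => hC s hs x
  · exact Filter.Eventually.of_forall fun x => h.contT x t ht

lemma TReg.intDeriv {T : ℝ} {w w' : ℝ → Ed d → ℝ} (h : TReg T w w') (t : ℝ)
    (ht : t ∈ Ioo (0:ℝ) T) :
    HasDerivAt (fun t => ∫ x in cube d, w t x) (∫ x in cube d, w' t x) t := by
  obtain ⟨C, hC⟩ := h.bdd'
  have hn : Ioo (0:ℝ) T ∈ nhds t := isOpen_Ioo.mem_nhds ht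
  refine (hasDerivAt_integral_of_dominated_loc_of_deriv_le (bound := fun _ => C) hn ?_ ?_ ?_ ?_
    (integrable_const _) ?_).2
  · filter_upwards [hn] with s hs
    exact (h.cont s (Ioo_subset_Icc_self hs)).aestronglyMeasurable
  · exact cube_int (h.cont t (Ioo_subset_Icc_self ht))
  · exact (h.cont' t ht).aestronglyMeasurable
  · exact Filter.Eventually.of_forall fun x s hs => hC s hs x
  · exact Filter.Eventually.of_forall fun x s hs => h.deriv s hs x

lemma holder_cont {T a : ℝ} (ha : 0 < a) {w : ℝ → Ed d → ℝ} (h : HolderBddQ T a w) (t : ℝ)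
    (ht : t ∈ Icc (0:ℝ) T) : Continuous (w t) := by
  obtain ⟨C, -, hC⟩ := h
  rw [continuous_iff_continuousAt]
  intro x
  rw [ContinuousAt, tendsto_iff_dist_tendsto_zero]
  have hlim : Filter.Tendsto (fun y : Ed d => C * (‖y - x‖ ^ 2 + |t - t|) ^ (a / 2))
      (nhds x) (nhds 0) := by
    have : Continuous fun y : Ed d => C * (‖y - x‖ ^ 2 + |t - t|) ^ (a / 2) := by
      refine continuous_const.mul (Continuous.rpow_const (by fun_prop) ?_)
      intro y
      right
      positivity
    have h2 := this.tendsto x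
    simpa [Real.zero_rpow (by positivity : a / 2 ≠ 0)] using h2
  refine squeeze_zero (fun _ => dist_nonneg) (fun y => ?_) hlim
  exact hC t ht t ht y x

lemma InC2alpha.treg {T a : ℝ} (ha : 0 < a) {w : ℝ → Ed d → ℝ} (h : InC2alpha T a w) :
    TReg T w (fun t x => tderiv T w t x) := by
  obtain ⟨_, h2, h3, h4, _, _, h7⟩ := h
  refine ⟨fun t ht => (h2 t ht).continuous, ?_, fun x => (h3 x).continuousOn, ?_, ?_, ?_⟩
  · obtain ⟨C, hC, -⟩ := h4
    exact ⟨C, hC⟩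
  · exact fun t ht => holder_cont ha h7 t (Ioo_subset_Icc_self ht)
  · obtain ⟨C, hC, -⟩ := h7
    exact ⟨C, fun t ht => hC t (Ioo_subset_Icc_self ht)⟩
  · intro t ht x
    exact (h3 x t (Ioo_subset_Icc_self ht)).hasDerivWithinAt.hasDerivAt (Icc_mem_nhds ht.1 ht.2)

lemma norm_le_of_coord {x : Ed d} {C : Fin d → ℝ} (h : ∀ i, |⟪x, ebasis d i⟫| ≤ C i) :
    ‖x‖ ≤ ∑ i, C i := by
  conv_lhs => rw [← sum_ebasis x]
  refine (norm_sum_le _ _).trans (Finset.sum_le_sum fun i _ => ?_)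
  rw [norm_smul]
  simpa [ebasis] using h i

lemma zero_of_antitone_aux {T : ℝ} {φ φ' : ℝ → ℝ}
    (hc : ContinuousOn φ (Icc 0 T)) (hd : ∀ t ∈ Ioo 0 T, HasDerivAt φ (φ' t) t)
    (hn : ∀ t ∈ Ioo 0 T, φ' t ≤ 0) : AntitoneOn φ (Icc 0 T) := by
  apply antitoneOn_of_deriv_nonpos (convex_Icc 0 T) hc
  · rw [interior_Icc]
    exact fun t ht => (hd t ht).differentiableAt.differentiableWithinAt
  · rw [interior_Icc]
    intro t ht
    rw [(hd t ht).deriv]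
    exact hn t ht

lemma const_aux {T : ℝ} {φ : ℝ → ℝ}
    (hc : ContinuousOn φ (Icc 0 T)) (hd : ∀ t ∈ Ioo 0 T, HasDerivAt φ 0 t)
    (s t : ℝ) (hs : s ∈ Icc 0 T) (ht : t ∈ Icc 0 T) : φ s = φ t := by
  have h1 := zero_of_antitone_aux hc hd (fun _ _ => le_rfl)
  have h2 := zero_of_antitone_aux hc.neg (fun t ht => (hd t ht).neg) (fun _ _ => by simp)
  rcases le_total s t with h | h
  · have a := h1 hs ht h
    have b := h2 hs ht h
    simp only [Pi.neg_apply] at b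
    linarith
  · have a := h1 ht hs h
    have b := h2 ht hs h
    simp only [Pi.neg_apply] at b
    linarith

lemma gronwall_aux {T K : ℝ} {φ φ' : ℝ → ℝ}
    (hc : ContinuousOn φ (Icc 0 T)) (hd : ∀ t ∈ Ioo 0 T, HasDerivAt φ (φ' t) t)
    (hn : ∀ t ∈ Ioo 0 T, φ' t ≤ K * φ t) (h0 : φ 0 = 0) (t : ℝ) (ht : t ∈ Icc 0 T) : φ t ≤ 0 := by
  have hexp : ∀ t, HasDerivAt (fun t : ℝ => Real.exp (-K * t)) (Real.exp (-K * t) * (-K)) t := by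
    intro t
    have := ((hasDerivAt_id t).const_mul (-K)).exp
    simpa using this
  have h1 := zero_of_antitone_aux (φ := fun t => φ t * Real.exp (-K * t))
    (hc.mul (by fun_prop)) (fun t ht => (hd t ht).mul (hexp t)) (fun t ht => by
      have a := hn t ht
      have b := Real.exp_pos (-K * t)
      have : (φ' t - K * φ t) * Real.exp (-K * t) ≤ 0 :=
        mul_nonpos_of_nonpos_of_nonneg (by linarith) b.le
      linarith)
  have h2 := h1 (left_mem_Icc.2 (ht.1.trans ht.2)) ht ht.1
  simp only [h0, zero_mul] at h2
  exact nonpos_of_mul_nonpos_left h2 (Real.exp_pos _)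

lemma int_add3 {a b c : Ed d → ℝ} (ha : IntegrableOn a (cube d)) (hb : IntegrableOn b (cube d))
    (hc : IntegrableOn c (cube d)) :
    ∫ x in cube d, (a x + b x + c x) =
      (∫ x in cube d, a x) + (∫ x in cube d, b x) + ∫ x in cube d, c x := by
  have h1 : ∫ x in cube d, (a x + b x + c x) =
      (∫ x in cube d, (a x + b x)) + ∫ x in cube d, c x := integral_add (ha.add hb) hc
  rw [h1, integral_add ha hb]

lemma int_six {a b c e f g : Ed d → ℝ} (ha : IntegrableOn a (cube d))
    (hb : IntegrableOn b (cube d)) (hc : IntegrableOn c (cube d)) (he : IntegrableOn e (cube d))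
    (hf : IntegrableOn f (cube d)) (hg : IntegrableOn g (cube d)) :
    ∫ x in cube d, (a x + b x + c x + e x - f x - g x) =
      (∫ x in cube d, a x) + (∫ x in cube d, b x) + (∫ x in cube d, c x) +
      (∫ x in cube d, e x) - (∫ x in cube d, f x) - ∫ x in cube d, g x := by
  have h1 : ∫ x in cube d, (a x + b x + c x + e x - f x - g x) =
      (∫ x in cube d, (a x + b x + c x + e x - f x)) - ∫ x in cube d, g x :=
    integral_sub ((((ha.add hb).add hc).add he).sub hf) hg
  have h2 : ∫ x in cube d, (a x + b x + c x + e x - f x) =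
      (∫ x in cube d, (a x + b x + c x + e x)) - ∫ x in cube d, f x :=
    integral_sub (((ha.add hb).add hc).add he) hf
  have h3 : ∫ x in cube d, (a x + b x + c x + e x) =
      (∫ x in cube d, (a x + b x + c x)) + ∫ x in cube d, e x :=
    integral_add ((ha.add hb).add hc) he
  rw [h1, h2, h3, int_add3 ha hb hc]

lemma spatial_duality {v r k vt rt : Ed d → ℝ} {b F : Ed d → Ed d}
    (hv : ContDiff ℝ 2 v) (hr : ContDiff ℝ 2 r) (hb : ContDiff ℝ 1 b) (hF : ContDiff ℝ 1 F)
    (pv : VPer v) (pr : VPer r) (pb : VPer b) (pF : VPer F) (cvt : Continuous vt)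
    (e1 : ∀ x, -vt x - lap v x + ⟪b x, sgrad v x⟫ = k x)
    (e2 : ∀ x, rt x - lap r x - diverg (fun y => r y • b y) x = diverg F x) :
    ∫ x in cube d, (vt x * r x + v x * rt x) =
      - (∫ x in cube d, k x * r x) - ∫ x in cube d, ⟪F x, sgrad v x⟫ := by
  have hv1 : ContDiff ℝ 1 v := hv.of_le (by norm_num)
  have hr1 : ContDiff ℝ 1 r := hr.of_le (by norm_num)
  have gv := sgrad_contDiff hv
  have gr := sgrad_contDiff hr
  have hrb : ContDiff ℝ 1 (fun y => r y • b y) := hr1.smul hb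
  have prb : VPer (fun y => r y • b y) := fun x i => by simp only [pr x i, pb x i]
  have i1 := ibp hr1 gv pr (sgrad_per pv)
  have i2 := ibp hv1 gr pv (sgrad_per pr)
  have i3 := ibp hv1 hrb pv prb
  have i4 := ibp hv1 hF pv pF
  have c1 := diverg_cont gv
  have c2 := diverg_cont gr
  have c3 := diverg_cont hrb
  have c4 := diverg_cont hF
  have c5 := hv.continuous
  have c6 := hr.continuous
  have c7 := gv.continuous
  have c8 := gr.continuous
  have c9 := hb.continuous
  have ck : Continuous k := by
    have : k = fun x => -vt x - diverg (sgrad v) x + ⟪b x, sgrad v x⟫ := by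
      funext x
      rw [← e1 x, lap_eq hv]
    rw [this]
    fun_prop
  have j1 : IntegrableOn (fun x => r x * diverg (sgrad v) x) (cube d) := cube_int (by fun_prop)
  have j2 : IntegrableOn (fun x => v x * diverg (sgrad r) x) (cube d) := cube_int (by fun_prop)
  have j3 : IntegrableOn (fun x => v x * diverg (fun y => r y • b y) x) (cube d) :=
    cube_int (c5.mul c3)
  have j4 : IntegrableOn (fun x => v x * diverg F x) (cube d) := cube_int (by fun_prop)
  have j5 : IntegrableOn (fun x => ⟪r x • b x, sgrad v x⟫) (cube d) := cube_int (by fun_prop)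
  have j6 : IntegrableOn (fun x => k x * r x) (cube d) := cube_int (by fun_prop)
  have e : ∀ x, vt x * r x + v x * rt x =
      v x * diverg (sgrad r) x + v x * diverg (fun y => r y • b y) x + v x * diverg F x
      + ⟪r x • b x, sgrad v x⟫ - r x * diverg (sgrad v) x - k x * r x := by
    intro x
    have a1 := e1 x
    have a2 := e2 x
    rw [lap_eq hv] at a1
    rw [lap_eq hr] at a2
    rw [real_inner_smul_left]
    linear_combination (-r x) * a1 + v x * a2
  simp only [e]
  rw [int_six j2 j3 j4 j5 j1 j6, i1, i2, i3, i4]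
  have : ∫ x in cube d, ⟪sgrad r x, sgrad v x⟫ = ∫ x in cube d, ⟪sgrad v x, sgrad r x⟫ := by
    simp only [real_inner_comm]
  rw [this]
  ring

lemma spatial_energy {r rt : Ed d → ℝ} {b : Ed d → Ed d} {B : ℝ}
    (hr : ContDiff ℝ 2 r) (hb : ContDiff ℝ 1 b) (pr : VPer r) (pb : VPer b)
    (hB : ∀ x ∈ cube d, ‖b x‖ ≤ B)
    (e2 : ∀ x, rt x - lap r x - diverg (fun y => r y • b y) x = 0) :
    ∫ x in cube d, (rt x * r x + r x * rt x) ≤ (B ^ 2 / 2) * ∫ x in cube d, r x * r x := by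
  have hr1 : ContDiff ℝ 1 r := hr.of_le (by norm_num)
  have gr := sgrad_contDiff hr
  have hrb : ContDiff ℝ 1 (fun y => r y • b y) := hr1.smul hb
  have prb : VPer (fun y => r y • b y) := fun x i => by simp only [pr x i, pb x i]
  have i2 := ibp hr1 gr pr (sgrad_per pr)
  have i3 := ibp hr1 hrb pr prb
  have c2 := diverg_cont gr
  have c3 := diverg_cont hrb
  have c6 := hr.continuous
  have c8 := gr.continuous
  have c9 := hb.continuous
  have j2 : IntegrableOn (fun x => r x * diverg (sgrad r) x) (cube d) := cube_int (by fun_prop)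
  have j3 : IntegrableOn (fun x => r x * diverg (fun y => r y • b y) x) (cube d) :=
    cube_int (c6.mul c3)
  have j4 : IntegrableOn (fun x => ⟪sgrad r x, sgrad r x⟫) (cube d) := cube_int (by fun_prop)
  have j5 : IntegrableOn (fun x => ⟪r x • b x, sgrad r x⟫) (cube d) := cube_int (by fun_prop)
  have j6 : IntegrableOn (fun x => r x * r x) (cube d) := cube_int (by fun_prop)
  have e : ∀ x, rt x * r x + r x * rt x =
      2 * (r x * diverg (sgrad r) x + r x * diverg (fun y => r y • b y) x) := by
    intro x
    have a2 := e2 x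
    rw [lap_eq hr] at a2
    linear_combination 2 * r x * a2
  simp only [e]
  rw [integral_const_mul, integral_add j2 j3, i2, i3]
  have hle : ∫ x in cube d, (-2 * (⟪sgrad r x, sgrad r x⟫ + ⟪r x • b x, sgrad r x⟫)) ≤
      ∫ x in cube d, (B ^ 2 / 2) * (r x * r x) := by
    refine setIntegral_mono_on ((j4.add j5).const_mul _) (j6.const_mul _) cube_meas ?_
    intro x hx
    have h1 := hB x hx
    have h2 : |⟪b x, sgrad r x⟫| ≤ B * ‖sgrad r x‖ :=
      (abs_real_inner_le_norm _ _).trans (by gcongr)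
    rw [real_inner_self_eq_norm_sq, real_inner_smul_left]
    have h3 : -(r x * ⟪b x, sgrad r x⟫) ≤ |r x| * (B * ‖sgrad r x‖) := by
      refine (neg_le_abs _).trans ?_
      rw [abs_mul]
      gcongr
    have h4 : r x * r x = |r x| ^ 2 := by rw [sq_abs]; ring
    rw [h4]
    nlinarith [sq_nonneg (2 * ‖sgrad r x‖ - B * |r x|)]
  rw [integral_const_mul, integral_const_mul, integral_add j4 j5] at hle
  linarith

lemma kernel_swap (K : Ed d → Ed d → ℝ) (r : Ed d → ℝ) :
    ∫ x in cube d, (∫ y in cube d, K x y * r y) * r x =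
      ∫ x in cube d, ∫ y in cube d, K x y * r x * r y := by
  congr 1
  funext x
  rw [← integral_mul_const]
  congr 1
  funext y
  ring

/-- Lemma `stable nonlocal`: let `(u,m)` be a classical solution
of the nonlocal MFG system with `m > 0` on `Q`, and let `K_f, K_g` be
continuous kernels with the positivity property. Then any classical solution
`(v,ρ)` of the linearized system
(i)  `-∂ₜv - Δv + H_p(x,Du)·Dv = ∫ K_f(x,t,y)ρ(y,t) dy`;
(ii) `∂ₜρ - Δρ - div(ρH_p(x,Du)) = div(mH_pp(x,Du)Dv)`;
with `ρ(·,0) = 0` and `v(x,T) = ∫ K_g(x,y)ρ(y,T) dy`, is the trivial solution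
`(v,ρ) = (0,0)`. -/
theorem linearized_nonlocal_mfg_uniqueness
    (d : ℕ) (hd : 1 ≤ d) (T α ϑ : ℝ) (hT : 0 < T) (hα : α ∈ Ioo (0:ℝ) 1)
    (hϑ : 0 < ϑ) (H : Ed d → Ed d → ℝ) (hH : HAssumpNonlocal H)
    (f g : (Ed d → ℝ) → Ed d → ℝ) (m0 : Ed d → ℝ)
    (hm0 : InC2alphaSpace α m0 ∧ (∀ x, ϑ ≤ m0 x) ∧ (∫ x in cube d, m0 x) = 1)
    (u m : ℝ → Ed d → ℝ) (hu : InC2alpha T α u) (hm : InC2alpha T α m)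
    (hsol : SolvesMFGNonlocal T H f g m0 u m)
    (hmpos : ∀ t ∈ Icc (0:ℝ) T, ∀ x : Ed d, 0 < m t x)
    (Kf : Ed d → ℝ → Ed d → ℝ) (Kg : Ed d → Ed d → ℝ)
    (hK : KernelAssump T Kf Kg)
    (v ρ : ℝ → Ed d → ℝ) (hv : InC2alpha T α v) (hρ : InC2alpha T α ρ)
    (heq1 : ∀ t ∈ Icc (0:ℝ) T, ∀ x : Ed d,
      -tderiv T v t x - lap (v t) x +
          ⟪HamP2 H x (sgrad (u t) x), sgrad (v t) x⟫ =
        ∫ y in cube d, Kf x t y * ρ t y)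
    (heq2 : ∀ t ∈ Icc (0:ℝ) T, ∀ x : Ed d,
      tderiv T ρ t x - lap (ρ t) x -
          diverg (fun y => ρ t y • HamP2 H y (sgrad (u t) y)) x =
        diverg (fun y =>
          m t y • HamPP2 H y (sgrad (u t) y) (sgrad (v t) y)) x)
    (hinit : ∀ x : Ed d, ρ 0 x = 0)
    (hterm : ∀ x : Ed d, v T x = ∫ y in cube d, Kg x y * ρ T y) :
    ∀ t ∈ Icc (0:ℝ) T, ∀ x : Ed d, v t x = 0 ∧ ρ t x = 0 := by
  obtain ⟨hHc, hHper, -, hHpos⟩ := hH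
  obtain ⟨-, -, -, -, -, -, hKf, hKg⟩ := hK
  have ha : 0 < α := hα.1
  have tv := hv.treg ha
  have tr := hρ.treg ha
  have hIoo : ∀ t ∈ Ioo (0:ℝ) T, t ∈ Icc (0:ℝ) T := fun t ht => Ioo_subset_Icc_self ht
  have hPper : ∀ (p x : Ed d) (i : Fin d), H (x + ebasis d i) = H x := fun p x i =>
    funext fun q => hHper q x i
  have hPc := HamP2_contDiff hHc
  have hPPc := HamPP2_contDiff hHc
  have bC : ∀ t ∈ Icc (0:ℝ) T, ContDiff ℝ 1 (fun y => HamP2 H y (sgrad (u t) y)) := by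
    intro t ht
    exact (hPc.of_le (by norm_num)).comp (contDiff_id.prodMk (sgrad_contDiff (hu.2.1 t ht)))
  have bP : ∀ t ∈ Icc (0:ℝ) T, VPer (fun y => HamP2 H y (sgrad (u t) y)) := by
    intro t ht x i
    simp only [sgrad_per (hu.1 t ht) x i, HamP2, hPper 0 x i]
  have FC : ∀ t ∈ Icc (0:ℝ) T, ContDiff ℝ 1
      (fun y => m t y • HamPP2 H y (sgrad (u t) y) (sgrad (v t) y)) := by
    intro t ht
    have h1 : ContDiff ℝ 1 (fun y => HamPP2 H y (sgrad (u t) y)) :=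
      (hPPc.of_le (by norm_num)).comp (contDiff_id.prodMk (sgrad_contDiff (hu.2.1 t ht)))
    exact ((hm.2.1 t ht).of_le (by norm_num)).smul (h1.clm_apply (sgrad_contDiff (hv.2.1 t ht)))
  have FP : ∀ t ∈ Icc (0:ℝ) T, VPer
      (fun y => m t y • HamPP2 H y (sgrad (u t) y) (sgrad (v t) y)) := by
    intro t ht x i
    have h1 : m t (x + ebasis d i) = m t x := hm.1 t ht x i
    simp only [sgrad_per (hu.1 t ht) x i, sgrad_per (hv.1 t ht) x i, HamPP2, HamP2, hPper 0 x i, h1]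
  -- zero mass
  have hmass : ∀ t ∈ Icc (0:ℝ) T, ∫ x in cube d, ρ t x = 0 := by
    intro t ht
    have hc := tr.intCont
    have hd : ∀ s ∈ Ioo (0:ℝ) T, HasDerivAt (fun t => ∫ x in cube d, ρ t x) 0 s := by
      intro s hs
      have hs' := hIoo s hs
      have h1 := tr.intDeriv s hs
      have hr := hρ.2.1 s hs'
      have hr1 : ContDiff ℝ 1 (ρ s) := hr.of_le (by norm_num)
      have pr : VPer (ρ s) := hρ.1 s hs'
      have hrb : ContDiff ℝ 1 (fun y => ρ s y • HamP2 H y (sgrad (u s) y)) := hr1.smul (bC s hs')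
      have prb : VPer (fun y => ρ s y • HamP2 H y (sgrad (u s) y)) := fun x i => by
        have := bP s hs' x i
        simp only at this
        simp only [pr x i, this]
      have e : ∀ x, tderiv T ρ s x = diverg (sgrad (ρ s)) x +
          diverg (fun y => ρ s y • HamP2 H y (sgrad (u s) y)) x +
          diverg (fun y => m s y • HamPP2 H y (sgrad (u s) y) (sgrad (v s) y)) x := by
        intro x
        have := heq2 s hs' x
        rw [lap_eq hr] at this
        linarith
      simp only [e] at h1
      have k1 := cube_int (diverg_cont (sgrad_contDiff hr))
      have k2 := cube_int (diverg_cont hrb)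
      have k3 := cube_int (diverg_cont (FC s hs'))
      rw [int_add3 k1 k2 k3, int_diverg (sgrad_contDiff hr)
        (sgrad_per pr), int_diverg hrb prb, int_diverg (FC s hs') (FP s hs')] at h1
      simpa using h1
    have := const_aux hc hd t 0 ht (left_mem_Icc.2 hT.le)
    simpa [hinit] using this
  -- duality
  have tvr := tv.mul tr
  have hFnn : ∀ t ∈ Icc (0:ℝ) T, ∀ x,
      0 ≤ ⟪m t x • HamPP2 H x (sgrad (u t) x) (sgrad (v t) x), sgrad (v t) x⟫ := by
    intro t ht x
    rw [real_inner_smul_left]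
    refine mul_nonneg (hmpos t ht x).le ?_
    by_cases h0 : sgrad (v t) x = 0
    · simp [h0]
    · exact (hHpos _ _ _ h0).le
  have hder : ∀ t ∈ Ioo (0:ℝ) T, HasDerivAt (fun t => ∫ x in cube d, v t x * ρ t x)
      (- (∫ x in cube d, ∫ y in cube d, Kf x t y * ρ t x * ρ t y) - ∫ x in cube d,
        ⟪m t x • HamPP2 H x (sgrad (u t) x) (sgrad (v t) x), sgrad (v t) x⟫) t := by
    intro t ht
    have ht' := hIoo t ht
    have h1 := tvr.intDeriv t ht
    rw [spatial_duality (hv.2.1 t ht') (hρ.2.1 t ht') (bC t ht') (FC t ht') (hv.1 t ht')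
      (hρ.1 t ht') (bP t ht') (FP t ht') (tv.cont' t ht) (heq1 t ht') (heq2 t ht'),
      kernel_swap (fun x y => Kf x t y) (ρ t)] at h1
    exact h1
  have hKpos : ∀ t ∈ Icc (0:ℝ) T,
      0 ≤ ∫ x in cube d, ∫ y in cube d, Kf x t y * ρ t x * ρ t y := fun t ht =>
    hKf t ht (ρ t) (hρ.2.1 t ht).continuous (hρ.1 t ht) (hmass t ht)
  have hFint : ∀ t ∈ Icc (0:ℝ) T, 0 ≤ ∫ x in cube d,
        ⟪m t x • HamPP2 H x (sgrad (u t) x) (sgrad (v t) x), sgrad (v t) x⟫ := fun t ht =>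
    integral_nonneg fun x => hFnn t ht x
  have hanti := zero_of_antitone_aux tvr.intCont hder (fun t ht => by
    have := hKpos t (hIoo t ht)
    have := hFint t (hIoo t ht)
    linarith)
  have h0mem : (0:ℝ) ∈ Icc (0:ℝ) T := left_mem_Icc.2 hT.le
  have hTmem : T ∈ Icc (0:ℝ) T := right_mem_Icc.2 hT.le
  have hend : 0 ≤ ∫ x in cube d, v T x * ρ T x := by
    simp only [hterm]
    rw [kernel_swap Kg (ρ T)]
    exact hKg (ρ T) (hρ.2.1 T hTmem).continuous (hρ.1 T hTmem) (hmass T hTmem)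
  have hzero : ∀ t ∈ Icc (0:ℝ) T, ∫ x in cube d, v t x * ρ t x = 0 := by
    intro t ht
    have a1 := hanti h0mem ht ht.1
    have a2 := hanti ht hTmem ht.2
    simp only [hinit, mul_zero, integral_zero] at a1 a2
    linarith
  have hDv : ∀ t ∈ Ioo (0:ℝ) T, ∀ x, sgrad (v t) x = 0 := by
    intro t ht x
    have ht' := hIoo t ht
    have h1 : HasDerivAt (fun t => ∫ x in cube d, v t x * ρ t x) 0 t := by
      refine (hasDerivAt_const t (0:ℝ)).congr_of_eventuallyEq ?_
      filter_upwards [isOpen_Ioo.mem_nhds ht] with s hs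
      exact hzero s (hIoo s hs)
    have h2 := (hder t ht).unique h1
    have h3 := hKpos t ht'
    have h4 := hFint t ht'
    have gv := sgrad_contDiff (hv.2.1 t ht')
    have pgv := sgrad_per (hv.1 t ht')
    have h5 := zero_of_int ((FC t ht').continuous.inner gv.continuous) (fun x i => by
      exact congrArg₂ (fun p q : Ed d => ⟪p, q⟫) (FP t ht' x i) (pgv x i)) (hFnn t ht') (by linarith) x
    by_contra h0
    rw [real_inner_smul_left] at h5
    have := mul_pos (hmpos t ht' x) (hHpos x (sgrad (u t) x) _ h0)
    linarith
  -- bound on the drift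
  obtain ⟨B, hB⟩ : ∃ B : ℝ, ∀ t ∈ Icc (0:ℝ) T, ∀ x ∈ cube d,
      ‖HamP2 H x (sgrad (u t) x)‖ ≤ B := by
    obtain ⟨R, hR⟩ := cube_bdd (d := d)
    choose C hC _ using hu.2.2.2.2.1
    obtain ⟨B, hB⟩ := ((isCompact_closedBall (0 : Ed d) R).prod
      (isCompact_closedBall (0 : Ed d) (∑ i, C i))).exists_bound_of_continuousOn
      hPc.continuous.continuousOn
    refine ⟨B, fun t ht x hx => hB (x, sgrad (u t) x) ⟨hR hx, ?_⟩⟩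
    rw [mem_closedBall_zero_iff]
    exact norm_le_of_coord fun i => hC i t ht x
  have trr := tr.mul tr
  have hrho : ∀ t ∈ Icc (0:ℝ) T, ∀ x, ρ t x = 0 := by
    intro t ht x
    have h1 := gronwall_aux (K := B ^ 2 / 2) trr.intCont trr.intDeriv (fun s hs => by
      have hs' := hIoo s hs
      refine spatial_energy (hρ.2.1 s hs') (bC s hs') (hρ.1 s hs') (bP s hs') (hB s hs') ?_
      intro x
      rw [heq2 s hs' x]
      simp [hDv s hs, diverg]) (by simp [hinit]) t ht
    have c := (hρ.2.1 t ht).continuous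
    have pr : VPer (ρ t) := hρ.1 t ht
    have h2 := zero_of_int (c.mul c) (fun x i => by simp only [Pi.mul_apply, pr x i])
      (fun x => mul_self_nonneg _)
      (le_antisymm h1 (integral_nonneg fun x => mul_self_nonneg _)) x
    exact mul_self_eq_zero.1 h2
  intro t ht x
  refine ⟨?_, hrho t ht x⟩
  have h1 := const_aux (tv.contT x) (fun s hs => by
    have hs' := hIoo s hs
    have h := tv.deriv s hs x
    have e := heq1 s hs' x
    have e0 : sgrad (v s) = fun _ => 0 := funext (hDv s hs)
    have e3 : tderiv T v s x = 0 := by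
      rw [lap_eq (hv.2.1 s hs'), e0] at e
      simpa [hrho s hs', diverg] using e
    rw [e3] at h
    exact h) t T ht hTmem
  rw [h1, hterm x]
  simp [hrho T hTmem]
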